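/- Assume q ≡ 3 (mod 4) (equivalently q ≡ −1 (mod 4)). Then there do not exist additive bijections M and L of F such that M(x) ⋆ M(y) = L(x * y) for all x, y ∈ F; that is, the LMPTB commutative semifield P(q, ℓ) and the BHB commutative presemifield with parameters d = 2 and β = β̄ are not strongly isotopic. -/

import Mathlib

lemma aux_indep {K F : Type*} [Field K] [Field F] [Algebra K F] [FiniteDimensional K F]
    (a : (F ≃ₐ[K] F) → F) (h : ∀ x, ∑ g, a g * g x = 0) : ∀ g, a g = 0 := by
  have hli : LinearIndependent F (fun g : F ≃ₐ[K] F => ((g : F →* F) : F → F)) :=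
    (linearIndependent_monoidHom F F).comp (fun g : F ≃ₐ[K] F => (g : F →* F))
      (fun g g' hgg => by
        ext x
        exact DFunLike.congr_fun hgg x)
  rw [Fintype.linearIndependent_iff] at hli
  apply hli a
  funext x
  simpa [Finset.sum_apply] using h x

lemma aux_indep2 {K F : Type*} [Field K] [Field F] [Algebra K F] [FiniteDimensional K F]
    (a b : (F ≃ₐ[K] F) → (F ≃ₐ[K] F) → F)
    (h : ∀ x y, ∑ g, ∑ k, a g k * (g x * k y) = ∑ g, ∑ k, b g k * (g x * k y)) :
    ∀ g k, a g k = b g k := by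
  intro g k
  have h1 : ∀ y, ∀ g, ∑ k, (a g k - b g k) * k y = 0 := by
    intro y
    apply aux_indep (K := K) (fun g => ∑ k, (a g k - b g k) * k y)
    intro x
    have := h x y
    rw [← sub_eq_zero, ← Finset.sum_sub_distrib] at this
    rw [← this]
    refine Finset.sum_congr rfl fun g _ => ?_
    rw [← Finset.sum_sub_distrib, Finset.sum_mul]
    refine Finset.sum_congr rfl fun k _ => ?_
    ring
  have := aux_indep (K := K) (fun k => a g k - b g k) (fun y => h1 y g) k
  exact sub_eq_zero.mp this

lemma aux_span {K F : Type*} [Field K] [Field F] [Algebra K F] [FiniteDimensional K F]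
    [IsGalois K F] (M : F →ₗ[K] F) : ∃ m : (F ≃ₐ[K] F) → F, ∀ x, M x = ∑ g, m g * g x := by
  have hli : LinearIndependent F (fun g : F ≃ₐ[K] F => (g : F →ₗ[K] F)) := by
    rw [Fintype.linearIndependent_iff]
    intro a ha
    apply aux_indep (K := K) a
    intro x
    have := LinearMap.congr_fun ha x
    simpa [LinearMap.sum_apply] using this
  have hs := hli.span_eq_top_of_card_eq_finrank (by
    rw [Module.finrank_linearMap_self, ← IsGalois.card_aut_eq_finrank, Nat.card_eq_fintype_card])
  have hM : M ∈ Submodule.span F (Set.range (fun g : F ≃ₐ[K] F => (g : F →ₗ[K] F))) := by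
    rw [hs]; trivial
  rw [Submodule.mem_span_range_iff_exists_fun] at hM
  obtain ⟨m, hm⟩ := hM
  refine ⟨m, fun x => ?_⟩
  rw [← hm]
  simp [LinearMap.sum_apply]

lemma aux_core {K F : Type*} [Field K] [Field F] [Algebra K F] [FiniteDimensional K F]
    [IsGalois K F] (c σ : F ≃ₐ[K] F) (hc : c * c = 1) (hcomm : ∀ g, c * g = g * c)
    (hc1 : c ≠ 1) (hσ1 : σ ≠ 1) (hσc : σ ≠ c) (h2 : (2 : F) ≠ 0) (hE : ∀ e : F, c e = e → e * e ≠ -1)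
    (M R P : F →ₗ[K] F) (hR : ∀ u, R (c u) = R u)
    (h : ∀ x y, 2 * (M x * c (M y) + c (M x) * M y) = R (x * y) + P (x * σ y + σ x * y)) :
    M = 0 := by
  classical
  obtain ⟨m, hm⟩ := aux_span M
  obtain ⟨r, hr⟩ := aux_span R
  obtain ⟨n, hn⟩ := aux_span P
  have hcc : ∀ g : F ≃ₐ[K] F, c * (c * g) = g := fun g => by rw [← mul_assoc, hc, one_mul]
  have hcM : ∀ y, c (M y) = ∑ g, c (m (c * g)) * g y := by
    intro y
    rw [hm, map_sum, ← Equiv.sum_comp (Equiv.mulLeft c)]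
    refine Finset.sum_congr rfl fun g _ => ?_
    rw [map_mul, Equiv.coe_mulLeft]
    congr 1
    rw [← AlgEquiv.mul_apply, hcc]
  have hrc : ∀ g, r (c * g) = r g := by
    intro g
    have := aux_indep (K := K) (fun g => r (c * g) - r g) (by
      intro x
      have h1 := hR x
      rw [hr, hr, ← sub_eq_zero, ← Equiv.sum_comp (Equiv.mulLeft c), ← Finset.sum_sub_distrib] at h1
      rw [← h1]
      refine Finset.sum_congr rfl fun g _ => ?_
      rw [Equiv.coe_mulLeft, ← AlgEquiv.mul_apply (c * g) c, ← hcomm, hcc]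
      ring) g
    exact sub_eq_zero.mp this
  have key := aux_indep2 (K := K)
    (fun g k => 2 * (m g * c (m (c * k)) + c (m (c * g)) * m k))
    (fun g k => (if k = g then r g else 0) + ((if k = g * σ then n g else 0) +
      (if g = k * σ then n k else 0))) (by
    intro x y
    have h1 := h x y
    rw [hcM, hcM, hm, hm, hr, hn] at h1
    have e1 : ∑ g : F ≃ₐ[K] F, ∑ k : F ≃ₐ[K] F,
        2 * (m g * c (m (c * k)) + c (m (c * g)) * m k) * (g x * k y) =
        2 * ((∑ g, m g * g x) * (∑ g, c (m (c * g)) * g y) +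
          (∑ g, c (m (c * g)) * g x) * (∑ g, m g * g y)) := by
      rw [Finset.sum_mul_sum, Finset.sum_mul_sum, ← Finset.sum_add_distrib, Finset.mul_sum]
      refine Finset.sum_congr rfl fun g _ => ?_
      rw [← Finset.sum_add_distrib, Finset.mul_sum]
      refine Finset.sum_congr rfl fun k _ => ?_
      ring
    rw [e1, h1]
    simp only [add_mul, Finset.sum_add_distrib, ite_mul, zero_mul]
    congr 1
    · refine Finset.sum_congr rfl fun g _ => ?_
      simp
    · simp only [map_add, map_mul, mul_add, Finset.sum_add_distrib]
      congr 1
      · refine Finset.sum_congr rfl fun g _ => ?_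
        simp [AlgEquiv.mul_apply]
      · rw [Finset.sum_comm]
        refine Finset.sum_congr rfl fun g _ => ?_
        simp [AlgEquiv.mul_apply])
  have k1 : ∀ g, 2 * (2 * (m g * c (m (c * g)))) = r g := by
    intro g
    have := key g g
    simp only [if_true] at this
    have hne : g ≠ g * σ := fun hh => hσ1 (by simpa using hh.symm)
    rw [if_neg hne, add_zero, add_zero] at this
    rw [← this]; ring
  have k2 : ∀ g, 2 * (m g * c (m g) + c (m (c * g)) * m (c * g)) = 0 := by
    intro g
    have := key g (c * g)
    have hne0 : c * g ≠ g := fun hh => hc1 (by simpa using hh)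
    have hne1 : c * g ≠ g * σ := fun hh => hσc (by
      rw [hcomm] at hh
      exact (mul_left_cancel hh).symm)
    have hne2 : g ≠ c * g * σ := fun hh => hσc (by
      have h3 : g * (c * σ) = g * 1 := by
        rw [← mul_assoc, ← hcomm, ← hh, mul_one]
      have h4 := mul_left_cancel h3
      calc σ = c * (c * σ) := (hcc σ).symm
        _ = c := by rw [h4, mul_one])
    simp only [if_neg hne0, if_neg hne1, if_neg hne2, add_zero, hcc] at this
    exact this
  have hccx : ∀ x, c (c x) = x := fun x => by rw [← AlgEquiv.mul_apply, hc, AlgEquiv.one_apply]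
  have hzero : ∀ g, m (c * g) = 0 := by
    intro g
    by_contra hv
    have a1 := k1 g
    have a2 := k1 (c * g)
    rw [hrc, ← a1, hcc] at a2
    have a3 := mul_left_cancel₀ h2 (mul_left_cancel₀ h2 a2)
    have a4 := (mul_eq_zero.mp (k2 g)).resolve_left h2
    set u := m g
    set v := m (c * g)
    have hcv : c v ≠ 0 := by simpa using hv
    have he : c (u / v) = u / v := by
      rw [map_div₀, div_eq_div_iff hcv hv]
      linear_combination a3
    refine hE (u / v) he ?_
    nth_rw 2 [← he]
    rw [map_div₀]
    field_simp
    linear_combination a4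
  ext x
  rw [hm]
  simp only [LinearMap.zero_apply]
  refine Finset.sum_eq_zero fun g _ => ?_
  have := hzero (c * g)
  rw [hcc] at this
  rw [this, zero_mul]

lemma aux_pow {F : Type*} [Field F] [Fintype F] (N : ℕ) (hN : N < Fintype.card F) (hN1 : 1 < N)
    (h : ∀ x : F, x ^ N = x) : False := by
  classical
  have hX := FiniteField.X_pow_card_sub_X_ne_zero F hN1
  have hd := FiniteField.X_pow_card_sub_X_natDegree_eq F hN1
  have := Polynomial.card_roots' ((Polynomial.X : Polynomial F) ^ N - Polynomial.X)
  have h2 : (Finset.univ : Finset F).val ≤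
      ((Polynomial.X : Polynomial F) ^ N - Polynomial.X).roots := by
    rw [Finset.val_le_iff_val_subset]
    intro x _
    rw [Polynomial.mem_roots hX]
    simp [h x]
  have h3 := Multiset.card_le_card h2
  rw [hd] at this
  have h4 : Multiset.card (Finset.univ : Finset F).val = Fintype.card F := rfl
  omega

/-- Theorem 5.2: if `q ≡ 3 (mod 4)`, the LMPTB commutative semifield
`P(q,ℓ)` and the BHB commutative presemifield with parameters `d = 2`, `β = β̄` are NOT
strongly isotopic. -/
theorem stmt18 (p hexp q k ℓ : ℕ) (hp : p.Prime) (hpodd : Odd p) (hq : q = p ^ hexp)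
    (hh : 1 ≤ hexp) (hk : 1 ≤ k) (hℓ : ℓ = 2 * k + 1) (hq4 : q % 4 = 3)
    (F : Type*) [Field F] [Fintype F] (hcard : Fintype.card F = q ^ (2 * ℓ))
    (ω : F) (hω0 : ω ≠ 0) (hωq : ω ^ q = -ω)
    (β : F) (hβ : β ^ (q ^ 2) = β) (hβω : β ^ (q + 1) * ω ^ 2 = 1)
    (G : F → F)
    (hG : ∀ u : F, G u =
      (∑ i ∈ Finset.Icc 1 k, (-1 : F) ^ i * (u - u ^ (q ^ ℓ)) ^ (q ^ (2 * i))) +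
      (∑ j ∈ Finset.Icc 1 (k - 1), (-1 : F) ^ (k + j) * (u - u ^ (q ^ ℓ)) ^ (q ^ (2 * j + 1))))
    (lmptb bhb : F → F → F)
    (hlmptb : ∀ x y : F, lmptb x y =
      (2 : F)⁻¹ * (x * y + x ^ (q ^ ℓ) * y ^ (q ^ ℓ)) +
      (4 : F)⁻¹ * G (x * y ^ (q ^ 2) + x ^ (q ^ 2) * y))
    (hbhb : ∀ x y : F, bhb x y =
      x * y ^ (q ^ ℓ) + x ^ (q ^ ℓ) * y +
      (β * (x * y ^ (q ^ 2) + x ^ (q ^ 2) * y) +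
        β ^ (q ^ ℓ) * (x * y ^ (q ^ 2) + x ^ (q ^ 2) * y) ^ (q ^ ℓ)) * ω) :
    ¬ ∃ M L : F ≃+ F, ∀ x y : F, bhb (M x) (M y) = L (lmptb x y) := by
  rintro ⟨M, L, hML⟩
  haveI : Fact p.Prime := ⟨hp⟩
  have hcard' : Fintype.card F = p ^ (hexp * (2 * ℓ)) := by rw [hcard, hq, ← pow_mul]
  haveI : CharP F p := charP_of_card_eq_prime_pow hcard'
  letI : Algebra (ZMod p) F := ZMod.algebra F p
  have hp3 : 3 ≤ q := by omega
  let φ : F ≃ₐ[ZMod p] F := FiniteField.frobeniusAlgEquivOfAlgebraic (ZMod p) F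
  have hφ : ∀ n x, (φ ^ (hexp * n)) x = x ^ (q ^ n) := by
    intro n x
    rw [AlgEquiv.coe_pow, FiniteField.coe_frobeniusAlgEquivOfAlgebraic_iterate, ZMod.card, hq,
      pow_mul]
  have hne : ∀ n, 1 ≤ n → n < 2 * ℓ → ∃ x : F, x ^ (q ^ n) ≠ x := by
    intro n h1 hn
    by_contra hcon
    push Not at hcon
    refine aux_pow (q ^ n) ?_ (Nat.one_lt_pow (by omega) (by omega)) hcon
    rw [hcard]
    exact Nat.pow_lt_pow_right (by omega) hn
  have hadd : ∀ n (x y : F), (x + y) ^ (q ^ n) = x ^ (q ^ n) + y ^ (q ^ n) := by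
    intro n x y
    rw [← hφ, ← hφ, ← hφ, map_add]
  have hsub : ∀ n (x y : F), (x - y) ^ (q ^ n) = x ^ (q ^ n) - y ^ (q ^ n) := by
    intro n x y
    rw [← hφ, ← hφ, ← hφ, map_sub]
  have hGadd : ∀ u v, G (u + v) = G u + G v := by
    intro u v
    have e : u + v - (u + v) ^ (q ^ ℓ) = (u - u ^ (q ^ ℓ)) + (v - v ^ (q ^ ℓ)) := by
      rw [hadd]; ring
    rw [hG, hG, hG, e]
    simp only [hadd, mul_add, Finset.sum_add_distrib]
    ring
  have hpow1 : ∀ x : F, (x ^ (q ^ ℓ)) ^ (q ^ ℓ) = x := by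
    intro x
    rw [← pow_mul, ← pow_add, ← two_mul, ← hcard, FiniteField.pow_card]
  have hqodd : Odd q := Nat.odd_iff.mpr (by omega)
  have h2 : (2 : F) ≠ 0 := by
    haveI : NeZero (2 : F) := by
      refine ⟨fun h0 => ?_⟩
      have h1 : (p : ℕ) ∣ 2 := (CharP.cast_eq_zero_iff F p 2).mp (by exact_mod_cast h0)
      have := (Nat.prime_dvd_prime_iff_eq hp Nat.prime_two).mp h1
      subst this
      exact absurd hpodd (by decide)
    exact two_ne_zero
  have hωn : ∀ n, ω ^ (q ^ (2 * n + 1)) = -ω := by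
    intro n
    induction n with
    | zero => simpa using hωq
    | succ n ih =>
      have : q ^ (2 * (n + 1) + 1) = q ^ (2 * n + 1) * q * q := by ring
      rw [this, pow_mul, pow_mul, ih, hqodd.neg_pow, hωq, neg_neg, hωq]
  have hωℓ : ω ^ (q ^ ℓ) = -ω := by rw [hℓ]; exact hωn k
  have hqℓ : q ^ ℓ % 4 = 3 := by
    rw [hℓ, pow_succ, pow_mul, Nat.mul_mod, Nat.pow_mod, Nat.pow_mod q 2, hq4]
    norm_num
  let c : F ≃ₐ[ZMod p] F := φ ^ (hexp * ℓ)
  let σ : F ≃ₐ[ZMod p] F := φ ^ (hexp * 2)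
  have hc : ∀ x, c x = x ^ (q ^ ℓ) := hφ ℓ
  have hσ : ∀ x, σ x = x ^ (q ^ 2) := hφ 2
  have hcx : ∀ x, c (c x) = x := fun x => by rw [hc, hc, hpow1]
  let Λ : F →+ F := L.toAddMonoidHom + (c : F →+ F).comp L.toAddMonoidHom
  have hΛ : ∀ w, Λ w = L w + c (L w) := fun w => rfl
  let R : F →+ F := AddMonoidHom.mk' (fun u => Λ ((2 : F)⁻¹ * (u + c u))) (by
    intro u v
    rw [← map_add, map_add c]; congr 1; ring)
  let P : F →+ F := AddMonoidHom.mk' (fun u => Λ ((4 : F)⁻¹ * G u)) (by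
    intro u v
    rw [← map_add, hGadd]; congr 1; ring)
  have hM := aux_core c σ (by ext x; exact hcx x)
    (by intro g; ext x; simp only [AlgEquiv.mul_apply, hc, map_pow])
    (by
      intro h1
      obtain ⟨x, hx⟩ := hne ℓ (by omega) (by omega)
      exact hx (by rw [← hc, h1, AlgEquiv.one_apply]))
    (by
      intro h1
      obtain ⟨x, hx⟩ := hne 2 (by omega) (by omega)
      exact hx (by rw [← hσ, h1, AlgEquiv.one_apply]))
    (by
      intro h1
      obtain ⟨x, hx⟩ := hne 4 (by omega) (by omega)
      refine hx ?_
      have : x ^ (q ^ 4) = σ (σ x) := by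
        rw [hσ, hσ, ← pow_mul]; congr 1; ring
      rw [this, h1, hcx])
    h2
    (by
      intro e he hee
      rw [hc, ← Nat.div_add_mod (q ^ ℓ) 4, hqℓ, pow_add, pow_mul] at he
      have e4 : e ^ 4 = 1 := by linear_combination (e * e - 1) * hee
      rw [e4, one_pow, one_mul] at he
      have e0 : 2 * e = 0 := by linear_combination e * hee - he
      have e1 := (mul_eq_zero.mp e0).resolve_left h2
      rw [e1] at hee
      simp at hee)
    (M.toAddMonoidHom.toZModLinearMap p) (R.toZModLinearMap p) (P.toZModLinearMap p)
    (by
      intro u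
      change Λ ((2 : F)⁻¹ * (c u + c (c u))) = Λ ((2 : F)⁻¹ * (u + c u))
      rw [hcx, add_comm])
    (by
      intro x y
      change 2 * (M x * c (M y) + c (M x) * M y) =
        Λ ((2 : F)⁻¹ * (x * y + c (x * y))) + Λ ((4 : F)⁻¹ * G (x * σ y + σ x * y))
      have e1 : (2 : F)⁻¹ * (x * y + c (x * y)) + (4 : F)⁻¹ * G (x * σ y + σ x * y) =
          lmptb x y := by
        rw [hlmptb, map_mul, hc, hc, hσ, hσ]
      rw [← map_add, e1, hΛ, ← hML, hbhb]
      simp only [← hc, ← hσ]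
      have hcω : c ω = -ω := by rw [hc, hωℓ]
      generalize M x * σ (M y) + σ (M x) * M y = w
      simp only [map_add, map_mul, hcx, hcω]
      ring)
  have hM1 : M 1 = 0 := LinearMap.congr_fun hM 1
  have : (1 : F) = 0 := M.injective (by rw [hM1, map_zero])
  exact one_ne_zero this
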